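/- Let d ≥ 1, K ≥ 1, τ > 0 and S ≥ 0. Let A : ℝ^d → (symmetric d×d real matrices) be measurable with K^{-1}|ξ|² ≤ ⟨A(x)ξ, ξ⟩ ≤ K|ξ|² for all x, ξ ∈ ℝ^d and ‖A(x) − A(y)‖ ≤ K|x−y| for all x,y (operator norm). Let f : ℝ^d → [0,∞) be measurable and let b : ℝ^d → ℝ^d be measurable with |b(y)| ≤ S f(y) for all y. Define H(y,z) := −⟨b(y), ∇_x p_{τA(z)}(x,z)|_{x=y}⟩ + ½ tr[ (A(z) − A(y)) · ∇²_x p_{τA(z)}(x,z)|_{x=y} ]. Then there exists a constant c > 0, depending only on d and K, such that for all y, z ∈ ℝ^d, |H(y,z)| ≤ c (1 + S f(y)) τ^{-1/2} p̃^{K,τ}(y,z). -/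

import Mathlib

open MeasureTheory Real Filter
open scoped ENNReal RealInnerProductSpace

noncomputable section

abbrev Ed (d : ℕ) := EuclideanSpace ℝ (Fin d)

/-- Gaussian reference kernel `p̃^{K,τ}(x,y) = (4Kπτ)^{-d/2} exp(-|y-x|²/(4Kτ))`. -/
def gaussK (d : ℕ) (K τ : ℝ) (x y : Ed d) : ℝ :=
  (4 * K * Real.pi * τ) ^ (-(d : ℝ) / 2) * Real.exp (-‖y - x‖ ^ 2 / (4 * K * τ))

/-- Gaussian density with covariance matrix `a`:
`p_a(x,y) = (2π)^{-d/2} (det a)^{-1/2} exp(-½⟨a⁻¹(y-x), y-x⟩)`. -/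
def pG (d : ℕ) (a : Matrix (Fin d) (Fin d) ℝ) (x y : Ed d) : ℝ :=
  (2 * Real.pi) ^ (-(d : ℝ) / 2) * a.det ^ (-(1 : ℝ) / 2) *
    Real.exp (-(1 / 2) * ⟪Matrix.toEuclideanLin a⁻¹ (y - x), y - x⟫)

/-- Operator norm of a matrix acting between Euclidean spaces. -/
def opN {d m : ℕ} (a : Matrix (Fin d) (Fin m) ℝ) : ℝ :=
  ‖LinearMap.toContinuousLinearMap (Matrix.toEuclideanLin a)‖

/-- `(K,τ)`-ellipticity: `(τ/K)|ξ|² ≤ ⟨aξ, ξ⟩ ≤ Kτ|ξ|²` for all `ξ`. -/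
def IsElliptic {d : ℕ} (K τ : ℝ) (a : Matrix (Fin d) (Fin d) ℝ) : Prop :=
  ∀ ξ : Ed d, (τ / K) * ‖ξ‖ ^ 2 ≤ ⟪Matrix.toEuclideanLin a ξ, ξ⟫ ∧
    ⟪Matrix.toEuclideanLin a ξ, ξ⟫ ≤ K * τ * ‖ξ‖ ^ 2

/-- Gradient `∇_x p_a(x,y)` of the Gaussian density in the first variable. -/
def gradP (d : ℕ) (a : Matrix (Fin d) (Fin d) ℝ) (y x : Ed d) : Ed d :=
  gradient (fun w => pG d a w y) x

/-- Hessian `∇²_x p_a(x,y)` (as a continuous linear map) of the Gaussian density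
in the first variable. -/
def hessP (d : ℕ) (a : Matrix (Fin d) (Fin d) ℝ) (y x : Ed d) : Ed d →L[ℝ] Ed d :=
  fderiv ℝ (gradP d a y) x

/-- Localized norm `‖g‖_{L̃_p^q([s,t])}` (valued in `ℝ≥0∞`). -/
def tnorm (d : ℕ) (p q s t : ℝ) (g : ℝ → Ed d → ℝ) : ℝ≥0∞ :=
  ⨆ z : Ed d, (∫⁻ u in Set.Icc s t,
    (∫⁻ x in Metric.closedBall z 1, ENNReal.ofReal (|g u x| ^ p)) ^ (q / p)) ^ (1 / q)

instance (d : ℕ) : MeasurableSpace (Matrix (Fin d) (Fin d) ℝ) :=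
  (inferInstance : MeasurableSpace (Fin d → Fin d → ℝ))

/-- The trace of a product with the matrix of a linear map is at most the dimension times the
product of the operator norms. -/
lemma abs_trace_mul_of_le {d : ℕ} (B : Matrix (Fin d) (Fin d) ℝ) (H : Ed d →L[ℝ] Ed d) :
    |Matrix.trace (B * Matrix.of (fun i j => H (EuclideanSpace.single j (1 : ℝ)) i))| ≤
      d * (opN B * ‖H‖) := by
  have key : Matrix.trace (B * Matrix.of (fun i j => H (EuclideanSpace.single j (1 : ℝ)) i)) =
      ∑ j, (LinearMap.toContinuousLinearMap (Matrix.toEuclideanLin B))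
        (H (EuclideanSpace.single j (1 : ℝ))) j := by
    simp [Matrix.trace, Matrix.mul_apply, Matrix.toLpLin_apply, Matrix.mulVec, dotProduct]
  rw [key]
  refine (Finset.abs_sum_le_sum_abs _ _).trans ?_
  have hterm : ∀ j ∈ (Finset.univ : Finset (Fin d)),
      |(LinearMap.toContinuousLinearMap (Matrix.toEuclideanLin B))
        (H (EuclideanSpace.single j (1 : ℝ))) j| ≤ opN B * ‖H‖ := by
    intro j _
    have h1 := PiLp.norm_apply_le ((LinearMap.toContinuousLinearMap (Matrix.toEuclideanLin B))
        (H (EuclideanSpace.single j (1 : ℝ)))) j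
    rw [Real.norm_eq_abs] at h1
    refine h1.trans ((ContinuousLinearMap.le_opNorm _ _).trans ?_)
    refine mul_le_mul_of_nonneg_left ?_ (norm_nonneg _)
    simpa using H.le_opNorm (EuclideanSpace.single j (1 : ℝ))
  simpa using Finset.sum_le_sum hterm

lemma hasFDerivAt_pG {d : ℕ} {a : Matrix (Fin d) (Fin d) ℝ}
    (hsymm : (Matrix.toEuclideanLin a⁻¹).IsSymmetric) (x y : Ed d) :
    HasFDerivAt (fun w => pG d a w y)
      (pG d a x y • innerSL ℝ (Matrix.toEuclideanLin a⁻¹ (y - x))) x := by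
  set L := LinearMap.toContinuousLinearMap (Matrix.toEuclideanLin a⁻¹) with hL
  have hv : HasFDerivAt (fun w : Ed d => y - w) (-ContinuousLinearMap.id ℝ (Ed d)) x :=
    (hasFDerivAt_id x).const_sub y
  have hQ := (L.hasFDerivAt.comp x hv).inner ℝ hv
  have hE := ((hQ.const_mul (-(1 / 2 : ℝ))).exp).const_mul
    ((2 * Real.pi) ^ (-(d : ℝ) / 2) * a.det ^ (-(1 : ℝ) / 2))
  refine hE.congr_fderiv ?_
  ext u
  have hs : ⟪L u, y - x⟫ = ⟪L (y - x), u⟫ := by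
    rw [real_inner_comm]; exact (hsymm (y - x) u).symm
  have hs' : ⟪Matrix.toEuclideanLin a⁻¹ (y - x), u⟫ = ⟪L (y - x), u⟫ := rfl
  simp only [pG, _root_.smul_apply, ContinuousLinearMap.comp_apply,
    fderivInnerCLM_apply, ContinuousLinearMap.prod_apply, _root_.neg_apply,
    ContinuousLinearMap.id_apply, Function.comp_apply, inner_neg_right, inner_neg_left, map_neg,
    smul_eq_mul, innerSL_apply_apply, hs, hs']
  simp only [hL, LinearMap.coe_toContinuousLinearMap']
  ring

lemma gradP_eq {d : ℕ} {a : Matrix (Fin d) (Fin d) ℝ}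
    (hsymm : (Matrix.toEuclideanLin a⁻¹).IsSymmetric) (y x : Ed d) :
    gradP d a y x = pG d a x y • Matrix.toEuclideanLin a⁻¹ (y - x) := by
  refine HasGradientAt.gradient ?_
  rw [hasGradientAt_iff_hasFDerivAt]
  refine (hasFDerivAt_pG hsymm x y).congr_fderiv ?_
  ext u
  simp

lemma hessP_eq {d : ℕ} {a : Matrix (Fin d) (Fin d) ℝ}
    (hsymm : (Matrix.toEuclideanLin a⁻¹).IsSymmetric) (y x : Ed d) :
    hessP d a y x = pG d a x y •
      ((innerSL ℝ (Matrix.toEuclideanLin a⁻¹ (y - x))).smulRight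
          (Matrix.toEuclideanLin a⁻¹ (y - x)) -
        LinearMap.toContinuousLinearMap (Matrix.toEuclideanLin a⁻¹)) := by
  have hg : gradP d a y = fun w => pG d a w y •
      LinearMap.toContinuousLinearMap (Matrix.toEuclideanLin a⁻¹) (y - w) := by
    ext1 w; exact gradP_eq hsymm y w
  have hv : HasFDerivAt (fun w : Ed d => y - w) (-ContinuousLinearMap.id ℝ (Ed d)) x :=
    (hasFDerivAt_id x).const_sub y
  unfold hessP
  rw [hg]
  refine (((hasFDerivAt_pG hsymm x y).smul
    ((LinearMap.toContinuousLinearMap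
      (Matrix.toEuclideanLin a⁻¹)).hasFDerivAt.comp x hv)).congr_fderiv ?_).fderiv
  ext1 u
  simp
  module

section Elliptic

variable {d : ℕ} {K τ : ℝ} {a : Matrix (Fin d) (Fin d) ℝ}

lemma isSymmetric_toEuclideanLin (h : a.IsSymm) : (Matrix.toEuclideanLin a).IsSymmetric := by
  rw [Matrix.isSymmetric_toEuclideanLin_iff]
  simpa [Matrix.IsHermitian] using h.eq

lemma IsElliptic.le_det (h : IsElliptic K τ a) (ha : a.IsSymm) (hc : 0 ≤ τ / K) :
    (τ / K) ^ d ≤ a.det := by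
  have hH : a.IsHermitian := by simpa [Matrix.IsHermitian] using ha.eq
  rw [hH.det_eq_prod_eigenvalues]
  have hev : ∀ i ∈ (Finset.univ : Finset (Fin d)), τ / K ≤ hH.eigenvalues i := by
    intro i _
    have h1 := (h (hH.eigenvectorBasis i)).1
    have h2 : Matrix.toEuclideanLin a (hH.eigenvectorBasis i) =
        hH.eigenvalues i • hH.eigenvectorBasis i := by
      have := hH.mulVec_eigenvectorBasis i
      ext j
      simpa [Matrix.toLpLin_apply] using congrFun this j
    rw [h2, real_inner_smul_left, real_inner_self_eq_norm_sq] at h1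
    simpa using h1
  simpa [-Finset.prod_div_distrib] using Finset.prod_le_prod (fun _ _ => hc) hev

lemma toEuclideanLin_apply_inv_apply (hdet : a.det ≠ 0) (v : Ed d) :
    Matrix.toEuclideanLin a (Matrix.toEuclideanLin a⁻¹ v) = v := by
  simp [Matrix.toLpLin_apply, Matrix.mulVec_mulVec, Matrix.mul_nonsing_inv _ hdet.isUnit]

lemma IsElliptic.norm_inv_apply_le (h : IsElliptic K τ a) (hK : 0 < K) (hτ : 0 < τ)
    (hdet : a.det ≠ 0) (v : Ed d) : ‖Matrix.toEuclideanLin a⁻¹ v‖ ≤ K / τ * ‖v‖ := by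
  set w := Matrix.toEuclideanLin a⁻¹ v with hw
  have h1 := (h w).1
  rw [hw, toEuclideanLin_apply_inv_apply hdet, ← hw] at h1
  have h2 : τ / K * ‖w‖ ^ 2 ≤ ‖v‖ * ‖w‖ := h1.trans (real_inner_le_norm v w)
  rcases (norm_nonneg w).eq_or_lt with h0 | h0
  · rw [← h0]; positivity
  · have h3 : τ / K * ‖w‖ ≤ ‖v‖ := by
      refine le_of_mul_le_mul_right ?_ h0
      linarith
    calc ‖w‖ = K / τ * (τ / K * ‖w‖) := by field_simp
      _ ≤ _ := by gcongr

lemma IsElliptic.le_inner_inv (h : IsElliptic K τ a) (ha : a.IsSymm) (hK : 0 < K) (hτ : 0 < τ)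
    (hdet : a.det ≠ 0) (v : Ed d) :
    ‖v‖ ^ 2 / (K * τ) ≤ ⟪Matrix.toEuclideanLin a⁻¹ v, v⟫ := by
  set w := Matrix.toEuclideanLin a⁻¹ v with hw
  have haw : Matrix.toEuclideanLin a w = v := toEuclideanLin_apply_inv_apply hdet v
  set s := (K * τ)⁻¹ with hs
  have h1 := (h (w - s • v)).1
  have h0 : 0 ≤ τ / K * ‖w - s • v‖ ^ 2 := by positivity
  have h2 := (h v).2
  have hsym : ⟪Matrix.toEuclideanLin a v, w⟫ = ‖v‖ ^ 2 := by
    rw [isSymmetric_toEuclideanLin ha v w, haw, real_inner_self_eq_norm_sq]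
  have hexp : ⟪Matrix.toEuclideanLin a (w - s • v), w - s • v⟫ =
      ⟪w, v⟫ - 2 * s * ‖v‖ ^ 2 + s ^ 2 * ⟪Matrix.toEuclideanLin a v, v⟫ := by
    rw [map_sub, map_smul, haw]
    simp only [inner_sub_left, inner_sub_right, real_inner_smul_left, real_inner_smul_right, hsym,
      real_inner_self_eq_norm_sq, real_inner_comm v w]
    ring
  have h3 : s ^ 2 * ⟪Matrix.toEuclideanLin a v, v⟫ ≤ s * ‖v‖ ^ 2 := by
    calc _ ≤ s ^ 2 * (K * τ * ‖v‖ ^ 2) := by gcongr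
      _ = s * ‖v‖ ^ 2 := by rw [hs]; field_simp
  have h4 : ‖v‖ ^ 2 / (K * τ) = s * ‖v‖ ^ 2 := by rw [hs]; field_simp
  rw [h4]
  linarith

lemma pG_nonneg (hdet : 0 ≤ a.det) (x y : Ed d) : 0 ≤ pG d a x y := by
  unfold pG; positivity

/-- Comparison with the reference kernel; half of the Gaussian decay is left over. -/
lemma IsElliptic.pG_le (h : IsElliptic K τ a) (ha : a.IsSymm) (hK : 0 < K) (hτ : 0 < τ)
    (x y : Ed d) :
    pG d a x y ≤ (2 * K ^ 2) ^ ((d : ℝ) / 2) * gaussK d K τ x y *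
      Real.exp (-(‖y - x‖ ^ 2 / (4 * K * τ))) := by
  have hc : 0 < τ / K := by positivity
  have hle := h.le_det ha hc.le
  have hdet : 0 < a.det := lt_of_lt_of_le (by positivity) hle
  have hexp : Real.exp (-(1 / 2) * ⟪Matrix.toEuclideanLin a⁻¹ (y - x), y - x⟫) ≤
      Real.exp (-‖y - x‖ ^ 2 / (4 * K * τ)) * Real.exp (-(‖y - x‖ ^ 2 / (4 * K * τ))) := by
    rw [← Real.exp_add, Real.exp_le_exp]
    have := h.le_inner_inv ha hK hτ hdet.ne' (y - x)
    have he : -‖y - x‖ ^ 2 / (4 * K * τ) + -(‖y - x‖ ^ 2 / (4 * K * τ)) =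
        -(1 / 2) * (‖y - x‖ ^ 2 / (K * τ)) := by field_simp; ring
    rw [he]
    linarith
  have hd' : a.det ^ (-(1 : ℝ) / 2) ≤ (τ / K) ^ (-(d : ℝ) / 2) := by
    have h1 := Real.rpow_le_rpow_of_nonpos (by positivity : 0 < (τ / K) ^ d) hle
      (by norm_num : (-(1 : ℝ) / 2) ≤ 0)
    refine h1.trans_eq ?_
    rw [← Real.rpow_natCast, ← Real.rpow_mul hc.le]
    congr 1
    ring
  have hconst : (2 * Real.pi) ^ (-(d : ℝ) / 2) * (τ / K) ^ (-(d : ℝ) / 2) =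
      (2 * K ^ 2) ^ ((d : ℝ) / 2) * (4 * K * Real.pi * τ) ^ (-(d : ℝ) / 2) := by
    have h1 : (2 * K ^ 2) ^ ((d : ℝ) / 2) = ((2 * K ^ 2)⁻¹) ^ (-(d : ℝ) / 2) := by
      rw [Real.inv_rpow (by positivity), neg_div, Real.rpow_neg (by positivity), inv_inv]
    rw [h1, ← Real.mul_rpow (by positivity) (by positivity),
      ← Real.mul_rpow (by positivity) (by positivity)]
    congr 1
    field_simp
    ring
  unfold pG gaussK
  calc _ ≤ (2 * Real.pi) ^ (-(d : ℝ) / 2) * (τ / K) ^ (-(d : ℝ) / 2) *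
        (Real.exp (-‖y - x‖ ^ 2 / (4 * K * τ)) * Real.exp (-(‖y - x‖ ^ 2 / (4 * K * τ)))) := by
        gcongr
    _ = _ := by rw [hconst]; ring

lemma IsElliptic.norm_gradP_le (h : IsElliptic K τ a) (ha : a.IsSymm) (hK : 0 < K) (hτ : 0 < τ)
    (x y : Ed d) : ‖gradP d a y x‖ ≤ pG d a x y * (K / τ * ‖y - x‖) := by
  have hdet : 0 < a.det := lt_of_lt_of_le (by positivity) (h.le_det ha (by positivity))
  rw [gradP_eq (isSymmetric_toEuclideanLin ha.inv), norm_smul, Real.norm_eq_abs,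
    abs_of_nonneg (pG_nonneg hdet.le x y)]
  exact mul_le_mul_of_nonneg_left (h.norm_inv_apply_le hK hτ hdet.ne' _) (pG_nonneg hdet.le x y)

lemma IsElliptic.norm_hessP_le (h : IsElliptic K τ a) (ha : a.IsSymm) (hK : 0 < K) (hτ : 0 < τ)
    (x y : Ed d) :
    ‖hessP d a y x‖ ≤ pG d a x y * ((K / τ * ‖y - x‖) ^ 2 + K / τ) := by
  have hdet : 0 < a.det := lt_of_lt_of_le (by positivity) (h.le_det ha (by positivity))
  rw [hessP_eq (isSymmetric_toEuclideanLin ha.inv), norm_smul, Real.norm_eq_abs,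
    abs_of_nonneg (pG_nonneg hdet.le x y)]
  refine mul_le_mul_of_nonneg_left ((norm_sub_le _ _).trans (add_le_add ?_ ?_))
    (pG_nonneg hdet.le x y)
  · rw [ContinuousLinearMap.norm_smulRight_apply, innerSL_apply_norm, ← sq]
    exact pow_le_pow_left₀ (norm_nonneg _) (h.norm_inv_apply_le hK hτ hdet.ne' _) 2
  · exact ContinuousLinearMap.opNorm_le_bound _ (by positivity)
      (h.norm_inv_apply_le hK hτ hdet.ne')

end Elliptic

/-- Polynomial factors up to degree three are absorbed by a Gaussian. -/
lemma cubic_mul_exp_le {K : ℝ} (hK : 1 ≤ K) (r : ℝ) :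
    r * Real.exp (-(r ^ 2 / (4 * K))) ≤ 4 * K ∧
      r ^ 3 * Real.exp (-(r ^ 2 / (4 * K))) ≤ 32 * K ^ 2 := by
  set x := r ^ 2 / (4 * K) with hx
  have hx0 : 0 ≤ x := by positivity
  have hrx : r ^ 2 = 4 * K * x := by rw [hx]; field_simp
  have he := Real.quadratic_le_exp_of_nonneg hx0
  rw [Real.exp_neg, ← div_eq_mul_inv, ← div_eq_mul_inv, div_le_iff₀ (Real.exp_pos x),
    div_le_iff₀ (Real.exp_pos x)]
  constructor
  · calc r ≤ 1 + r ^ 2 := by nlinarith [sq_nonneg (r - 1)]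
      _ ≤ 4 * K * (1 + x + x ^ 2 / 2) := by rw [hrx]; nlinarith [sq_nonneg x]
      _ ≤ _ := by gcongr
  · calc r ^ 3 ≤ 1 + (r ^ 2) ^ 2 := by
          nlinarith [sq_nonneg (r ^ 2 - r), sq_nonneg (r - 1), sq_nonneg (r ^ 2 - 1)]
      _ ≤ 32 * K ^ 2 * (1 + x + x ^ 2 / 2) := by
          rw [hrx]
          nlinarith [sq_nonneg x, sq_nonneg K, mul_nonneg (sq_nonneg K) hx0]
      _ ≤ _ := by gcongr

/-- the bound (A1) on the first-order correction kernel
`H(y,z) = −⟨b(y), ∇_x p_{τA(z)}(y,z)⟩ + ½ tr[(A(z) − A(y)) ∇²_x p_{τA(z)}(y,z)]`: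
`|H(y,z)| ≤ c (1 + S f(y)) τ^{-1/2} p̃^{K,τ}(y,z)`. -/
theorem stmt16 (d : ℕ) (hd : 1 ≤ d) (K : ℝ) (hK : 1 ≤ K) :
    ∃ c > 0, ∀ τ S : ℝ, 0 < τ → 0 ≤ S →
      ∀ A : Ed d → Matrix (Fin d) (Fin d) ℝ, Measurable A →
        (∀ x, (A x).IsSymm) →
        (∀ (x : Ed d) (ξ : Ed d),
          K⁻¹ * ‖ξ‖ ^ 2 ≤ ⟪Matrix.toEuclideanLin (A x) ξ, ξ⟫ ∧
            ⟪Matrix.toEuclideanLin (A x) ξ, ξ⟫ ≤ K * ‖ξ‖ ^ 2) →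
        (∀ x y : Ed d, opN (A x - A y) ≤ K * ‖x - y‖) →
        ∀ f : Ed d → ℝ, Measurable f → (∀ y, 0 ≤ f y) →
          ∀ b : Ed d → Ed d, Measurable b → (∀ y, ‖b y‖ ≤ S * f y) →
            ∀ y z : Ed d,
              |(-⟪b y, gradP d (τ • A z) z y⟫ +
                  (1 / 2) * Matrix.trace ((A z - A y) *
                    Matrix.of (fun i j =>
                      hessP d (τ • A z) z y (EuclideanSpace.single j (1 : ℝ)) i)))| ≤
                c * (1 + S * f y) * τ ^ (-(1 : ℝ) / 2) * gaussK d K τ y z := by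
  have hK0 : 0 < K := by linarith
  set C : ℝ := (2 * K ^ 2) ^ ((d : ℝ) / 2) with hC
  have hC0 : 0 < C := by positivity
  set c₂ : ℝ := d * K / 2 * (K ^ 2 * (32 * K ^ 2) + K * (4 * K)) with hc₂
  have hc₂0 : 0 ≤ c₂ := by positivity
  refine ⟨C * (4 * K ^ 2 + c₂), by positivity, ?_⟩
  intro τ S hτ hS A _ hsymm hell hlip f _ hf b _ hb y z
  have ha : (τ • A z).IsSymm := (hsymm z).smul τ
  have hE : IsElliptic K τ (τ • A z) := by
    intro ξ
    obtain ⟨h1, h2⟩ := hell z ξ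
    have h3 : ⟪Matrix.toEuclideanLin (τ • A z) ξ, ξ⟫ =
        τ * ⟪Matrix.toEuclideanLin (A z) ξ, ξ⟫ := by
      rw [map_smul, LinearMap.smul_apply, real_inner_smul_left]
    rw [h3]
    constructor
    · calc τ / K * ‖ξ‖ ^ 2 = τ * (K⁻¹ * ‖ξ‖ ^ 2) := by ring
        _ ≤ _ := by gcongr
    · calc _ ≤ τ * (K * ‖ξ‖ ^ 2) := by gcongr
        _ = _ := by ring
  set P := pG d (τ • A z) y z with hP
  set G := gaussK d K τ y z with hG
  have hG0 : 0 ≤ G := by rw [hG]; unfold gaussK; positivity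
  set t := Real.sqrt τ with ht
  have ht0 : 0 < t := Real.sqrt_pos.2 hτ
  have htt : τ = t ^ 2 := (Real.sq_sqrt hτ.le).symm
  have hτt : τ ^ (-(1 : ℝ) / 2) = t⁻¹ := by
    rw [neg_div, Real.rpow_neg hτ.le, ← Real.sqrt_eq_rpow]
  set r := ‖z - y‖ / t with hr
  have hr0 : 0 ≤ r := by positivity
  have hzy : ‖z - y‖ = r * t := by rw [hr]; field_simp
  set e := Real.exp (-(r ^ 2 / (4 * K))) with he
  have hPle : P ≤ C * G * e := by
    have h1 := hE.pG_le ha hK0 hτ y z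
    have h2 : ‖z - y‖ ^ 2 / (4 * K * τ) = r ^ 2 / (4 * K) := by
      rw [hzy, htt]; field_simp
    rwa [h2] at h1
  obtain ⟨he1, he3⟩ := cubic_mul_exp_le hK r
  rw [← he] at he1 he3
  have hSf : 0 ≤ S * f y := mul_nonneg hS (hf y)
  have hdrift : |⟪b y, gradP d (τ • A z) z y⟫| ≤ S * f y * (C * G * t⁻¹ * (4 * K ^ 2)) := by
    calc _ ≤ ‖b y‖ * ‖gradP d (τ • A z) z y‖ := abs_real_inner_le_norm _ _
      _ ≤ S * f y * (P * (K / τ * ‖z - y‖)) :=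
        mul_le_mul (hb y) (hE.norm_gradP_le ha hK0 hτ y z) (norm_nonneg _) hSf
      _ ≤ S * f y * (C * G * e * (K / τ * ‖z - y‖)) := by gcongr
      _ = S * f y * (C * G * t⁻¹ * (K * (r * e))) := by rw [hzy, htt]; field_simp
      _ ≤ S * f y * (C * G * t⁻¹ * (K * (4 * K))) := by gcongr
      _ = _ := by ring
  have htrace : 1 / 2 * |Matrix.trace ((A z - A y) * Matrix.of (fun i j =>
      hessP d (τ • A z) z y (EuclideanSpace.single j (1 : ℝ)) i))| ≤ C * G * t⁻¹ * c₂ := by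
    calc _ ≤ 1 / 2 * (d * (opN (A z - A y) * ‖hessP d (τ • A z) z y‖)) := by
          gcongr; exact abs_trace_mul_of_le _ _
      _ ≤ 1 / 2 * (d * (K * ‖z - y‖ * (P * ((K / τ * ‖z - y‖) ^ 2 + K / τ)))) := by
          gcongr
          · exact hlip z y
          · exact hE.norm_hessP_le ha hK0 hτ y z
      _ ≤ 1 / 2 * (d * (K * ‖z - y‖ * (C * G * e * ((K / τ * ‖z - y‖) ^ 2 + K / τ)))) := by
          gcongr
      _ = C * G * t⁻¹ * (d * K / 2 * (K ^ 2 * (r ^ 3 * e) + K * (r * e))) := by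
          rw [hzy, htt]; field_simp
      _ ≤ _ := by rw [hc₂]; gcongr
  rw [hτt]
  calc _ ≤ |⟪b y, gradP d (τ • A z) z y⟫| + 1 / 2 * |Matrix.trace ((A z - A y) *
        Matrix.of (fun i j => hessP d (τ • A z) z y (EuclideanSpace.single j (1 : ℝ)) i))| := by
        refine (abs_add_le _ _).trans_eq ?_
        rw [abs_neg, abs_mul, abs_of_pos (by norm_num : (0 : ℝ) < 1 / 2)]
    _ ≤ S * f y * (C * G * t⁻¹ * (4 * K ^ 2)) + C * G * t⁻¹ * c₂ := add_le_add hdrift htrace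
    _ ≤ S * f y * (C * G * t⁻¹ * (4 * K ^ 2)) + C * G * t⁻¹ * c₂ +
        (C * G * t⁻¹ * (4 * K ^ 2) + S * f y * (C * G * t⁻¹ * c₂)) :=
        le_add_of_nonneg_right (by positivity)
    _ = _ := by ring
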